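/- arXiv:1412.0609 — 2 statements merged into one kernel-verified Lean document; each statement's English description precedes it below -/
import Mathlib

section
/- Let g be a continuous, positive, non-increasing function on [0,∞) and let r ∈ ℕ. Assume conditions (6) hold, i.e., A_0, …, A_{r−1} are finite. Let Q be a bounded perfect g-spline of order r on [0,∞) with finitely many knots. Then for every s = 1, 2, …, r and every t ≥ 0 (almost every t in the case s = r) one has |Q^{(s)}(t)| ≤ |P_r^{(s)}(t)|. -/
open Set Filter MeasureTheory
open scoped Topology

noncomputable section

/-- Weighted sup-norm `‖x‖_{C(S),w} = sup_{t ∈ S} |x t| / w t`. -/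
def wNorm (x w : ℝ → ℝ) (S : Set ℝ) : ℝ :=
  sSup ((fun t => |x t| / w t) '' S)

/-- Sup-norm `‖x‖_{C(S)} = sup_{t ∈ S} |x t|`. -/
def supNorm (x : ℝ → ℝ) (S : Set ℝ) : ℝ :=
  sSup ((fun t => |x t|) '' S)

/-- `G` is a perfect `g`-spline of order `r` on `[0,a]` with exactly `m` knots
`u 1 < ⋯ < u m` (where `u 0 = 0` and `u (m+1) = a`) and sign `ε ∈ {1,-1}`:
`G ∈ C^{r-1}[0,a]`, and on each open interval between consecutive knots `G` is
`r` times differentiable with `G^{(r)}(t) = ε·(-1)^i·g(t)` there. -/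
def PerfectSplineWith (g : ℝ → ℝ) (r : ℕ) (a : ℝ) (m : ℕ) (u : ℕ → ℝ) (ε : ℝ)
    (G : ℝ → ℝ) : Prop :=
  (ε = 1 ∨ ε = -1) ∧ u 0 = 0 ∧ u (m + 1) = a ∧ (∀ i ≤ m, u i < u (i + 1)) ∧
  ContDiffOn ℝ (r - 1 : ℕ) G (Icc 0 a) ∧
  ∀ i ≤ m, ContDiffOn ℝ (r : ℕ) G (Ioo (u i) (u (i + 1))) ∧
    ∀ s ∈ Ioo (u i) (u (i + 1)),
      iteratedDerivWithin r G (Ioo (u i) (u (i + 1))) s = ε * (-1 : ℝ) ^ i * g s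

/-- `Γ^r_{n,g}[0,a]`: perfect `g`-splines of order `r` on `[0,a]` with at most `n` knots. -/
def InGamma (g : ℝ → ℝ) (r n : ℕ) (a : ℝ) (G : ℝ → ℝ) : Prop :=
  ∃ m ≤ n, ∃ u : ℕ → ℝ, ∃ ε : ℝ, PerfectSplineWith g r a m u ε G

/-- `b 1 < ⋯ < b (n+r+1)` are `n+r+1` oscillation points of `G` on `[0,a]`
with respect to the weight `f`, as in (5). -/
def OscPointsAt (f : ℝ → ℝ) (r n : ℕ) (a : ℝ) (G : ℝ → ℝ) (b : ℕ → ℝ) : Prop :=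
  0 ≤ b 1 ∧ b (n + r + 1) = a ∧ (∀ i, 1 ≤ i → i < n + r + 1 → b i < b (i + 1)) ∧
  ∀ i, 1 ≤ i → i ≤ n + r + 1 →
    G (b i) = (-1 : ℝ) ^ (i + r + 1) * (wNorm G f (Icc 0 a) * f (b i))

/-- `G` has `n+r+1` oscillation points on `[0,a]`. -/
def HasOsc (f : ℝ → ℝ) (r n : ℕ) (a : ℝ) (G : ℝ → ℝ) : Prop :=
  ∃ b : ℕ → ℝ, OscPointsAt f r n a G b

/-- `G` is the extremal spline `G_{r,n,f,a}`: a member of `Γ^r_{n,g}[0,a]`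
with `n+r+1` oscillation points. -/
def IsExtremalSpline (f g : ℝ → ℝ) (r n : ℕ) (a : ℝ) (G : ℝ → ℝ) : Prop :=
  InGamma g r n a G ∧ HasOsc f r n a G

/-- Iterated antiderivatives: `g_0 = g`, `g_{k+1}(t) = ∫_0^t g_k`. -/
def gk (g : ℝ → ℝ) : ℕ → ℝ → ℝ
  | 0 => g
  | k + 1 => fun t => ∫ s in (0:ℝ)..t, gk g k s

/-- The constants `A_k` of the paper:
`A_0 = ∫_0^∞ g`, and
`A_k = ∫_0^∞ [ Σ_{s=0}^{k-1} (-1)^{k-s-1} A_s t^{k-s-1}/(k-s-1)! + (-1)^k g_k(t) ] dt`. -/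
def Acoef (g : ℝ → ℝ) : ℕ → ℝ
  | 0 => ∫ t in Ioi (0 : ℝ), g t
  | k + 1 => ∫ t in Ioi (0 : ℝ),
      ((∑ s : Fin (k + 1), (-1 : ℝ) ^ (k - s.1) * Acoef g s.1 * t ^ (k - s.1) /
        (Nat.factorial (k - s.1) : ℝ)) + (-1 : ℝ) ^ (k + 1) * gk g (k + 1) t)

/-- `P_k(t) = Σ_{s=0}^{k-1} (-1)^{k-s-1} A_s t^{k-s-1}/(k-s-1)! + (-1)^k g_k(t)`. -/
def Pfun (g : ℝ → ℝ) (k : ℕ) (t : ℝ) : ℝ :=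
  (∑ s : Fin k, (-1 : ℝ) ^ (k - 1 - s.1) * Acoef g s.1 * t ^ (k - 1 - s.1) /
    (Nat.factorial (k - 1 - s.1) : ℝ)) + (-1 : ℝ) ^ k * gk g k t

/-- Conditions (6): `A_0 < ∞` and `A_k < ∞` for `k = 1, …, r-1`,
expressed as integrability of the corresponding integrands over `(0,∞)`. -/
def Cond6 (g : ℝ → ℝ) (r : ℕ) : Prop :=
  IntegrableOn g (Ioi 0) ∧ ∀ k, 1 ≤ k → k ≤ r - 1 → IntegrableOn (Pfun g k) (Ioi 0)

/-- Membership in the class `W^r_{f,g}(ℝ₊)`: `x ∈ C[0,∞)` with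
`‖x‖_{C[0,∞),f} < ∞`, `x ∈ C^{r-1}[0,∞)`, `x^{(r-1)}` locally absolutely
continuous with `|x^{(r)}| ≤ g` a.e., the latter encoded by the increment bound
`|x^{(r-1)}(t) - x^{(r-1)}(s)| ≤ ∫_s^t g`. -/
def MemW (f g : ℝ → ℝ) (r : ℕ) (x : ℝ → ℝ) : Prop :=
  ContinuousOn x (Ici 0) ∧
  ContDiffOn ℝ (r - 1 : ℕ) x (Ici 0) ∧
  BddAbove ((fun t => |x t| / f t) '' Ici 0) ∧
  ∀ s t : ℝ, 0 ≤ s → s ≤ t →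
    |iteratedDerivWithin (r - 1) x (Ici 0) t - iteratedDerivWithin (r - 1) x (Ici 0) s| ≤
      ∫ u in s..t, g u

/-- The modulus of continuity `ω(D^k, δ)` of the `k`-th differentiation operator on
`W^r_{f,g}(ℝ₊)`. -/
def omegaD (f g : ℝ → ℝ) (r k : ℕ) (δ : ℝ) : ℝ :=
  sSup {y | ∃ x : ℝ → ℝ, MemW f g r x ∧ wNorm x f (Ici 0) ≤ δ ∧
    y = supNorm (iteratedDerivWithin k x (Ici 0)) (Ici 0)}

/-- A perfect `g`-spline of order `r` on `[0,∞)` with exactly `n` knots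
`u 1 < ⋯ < u n` (and `u 0 = 0`), sign `ε`. -/
def PerfectSplineInf (g : ℝ → ℝ) (r n : ℕ) (u : ℕ → ℝ) (ε : ℝ) (Q : ℝ → ℝ) : Prop :=
  (ε = 1 ∨ ε = -1) ∧ u 0 = 0 ∧ (∀ i < n, u i < u (i + 1)) ∧
  ContDiffOn ℝ (r - 1 : ℕ) Q (Ici 0) ∧
  (∀ i < n, ContDiffOn ℝ (r : ℕ) Q (Ioo (u i) (u (i + 1))) ∧
    ∀ s ∈ Ioo (u i) (u (i + 1)),
      iteratedDerivWithin r Q (Ioo (u i) (u (i + 1))) s = ε * (-1 : ℝ) ^ i * g s) ∧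
  ContDiffOn ℝ (r : ℕ) Q (Ioi (u n)) ∧
  ∀ s ∈ Ioi (u n), iteratedDerivWithin r Q (Ioi (u n)) s = ε * (-1 : ℝ) ^ n * g s

end

lemma aux_gk_cont {g : ℝ → ℝ} (hg : ContinuousOn g (Ici 0)) (k : ℕ) :
    ContinuousOn (gk g k) (Ici 0) ∧
    ∀ t ∈ Ici (0:ℝ), HasDerivWithinAt (gk g (k+1)) (gk g k t) (Ici 0) t := by
  have step : ∀ k, ContinuousOn (gk g k) (Ici 0) →
      ∀ t ∈ Ici (0:ℝ), HasDerivWithinAt (gk g (k+1)) (gk g k t) (Ici 0) t := by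
    intro k hk t ht
    have hc : Continuous (fun s : ℝ => gk g k (max s 0)) :=
      hk.comp_continuous (by fun_prop) (fun s => mem_Ici.2 (le_max_right _ _))
    have h1 := (hc.integral_hasStrictDerivAt 0 t).hasDerivAt.hasDerivWithinAt (s := Ici 0)
    have ht' : (0:ℝ) ≤ t := ht
    rw [max_eq_left ht'] at h1
    have heq : ∀ y ∈ Ici (0:ℝ), gk g (k+1) y = ∫ x in (0:ℝ)..y, gk g k (max x 0) := by
      intro y hy
      have hy' : (0:ℝ) ≤ y := hy
      change (∫ s in (0:ℝ)..y, gk g k s) = _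
      apply intervalIntegral.integral_congr
      intro x hx
      rw [uIcc_of_le hy'] at hx
      simp [max_eq_left hx.1]
    exact h1.congr heq (heq t ht)
  have hc : ∀ k, ContinuousOn (gk g k) (Ici 0) := by
    intro k
    induction k with
    | zero => exact hg
    | succ k ih => exact fun t ht => (step k ih t ht).continuousWithinAt
  exact ⟨hc k, step k (hc k)⟩

lemma aux_Pfun_zero (g : ℝ → ℝ) : Pfun g 0 = g := by
  funext t; simp [Pfun, gk]

lemma aux_Pfun_deriv {g : ℝ → ℝ} (hg : ContinuousOn g (Ici 0)) (k : ℕ) (t : ℝ)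
    (ht : t ∈ Ici (0:ℝ)) : HasDerivWithinAt (Pfun g (k+1)) (-Pfun g k t) (Ici 0) t := by
  have h1 : ∀ y, Pfun g (k+1) y = (∑ s : Fin k, (-1 : ℝ) ^ (k - 1 - s.1 + 1) * Acoef g s.1 *
      y ^ (k - 1 - s.1 + 1) / (Nat.factorial (k - 1 - s.1 + 1) : ℝ)) + Acoef g k
      + (-1 : ℝ) ^ (k+1) * gk g (k+1) y := by
    intro y
    unfold Pfun
    rw [Fin.sum_univ_castSucc]
    congr 2
    · apply Finset.sum_congr rfl
      intro s _
      have : k + 1 - 1 - (s.castSucc).1 = k - 1 - s.1 + 1 := by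
        have := s.2
        simp; omega
      rw [this]; simp
    · simp
  have h2 : HasDerivWithinAt (fun y => (∑ s : Fin k, (-1 : ℝ) ^ (k - 1 - s.1 + 1) * Acoef g s.1 *
      y ^ (k - 1 - s.1 + 1) / (Nat.factorial (k - 1 - s.1 + 1) : ℝ)) + Acoef g k
      + (-1 : ℝ) ^ (k+1) * gk g (k+1) y)
      ((∑ s : Fin k, (-1 : ℝ) ^ (k - 1 - s.1 + 1) * Acoef g s.1 *
      (((k - 1 - s.1 + 1 : ℕ) : ℝ) * t ^ (k - 1 - s.1)) / (Nat.factorial (k - 1 - s.1 + 1) : ℝ))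
      + (-1 : ℝ) ^ (k+1) * gk g k t) (Ici 0) t := by
    apply HasDerivWithinAt.add
    · apply HasDerivWithinAt.add_const
      apply HasDerivWithinAt.fun_sum
      intro s _
      apply HasDerivWithinAt.div_const
      apply HasDerivWithinAt.const_mul
      simpa using (hasDerivAt_pow (k - 1 - s.1 + 1) t).hasDerivWithinAt
    · exact ((aux_gk_cont hg k).2 t ht).const_mul _
  have h3 := h2.congr (fun y _ => h1 y) (h1 t)
  refine h3.congr_deriv ?_
  symm
  unfold Pfun
  rw [neg_add, ← Finset.sum_neg_distrib]
  congr 1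
  · apply Finset.sum_congr rfl
    intro s _
    rw [Nat.factorial_succ, pow_succ]
    have : (Nat.factorial (k - 1 - s.1) : ℝ) ≠ 0 := by positivity
    have h' : ((k - 1 - s.1 + 1 : ℕ) : ℝ) ≠ 0 := by positivity
    push_cast at h' ⊢
    field_simp
  · ring

lemma aux_Pfun_iter {g : ℝ → ℝ} (hg : ContinuousOn g (Ici 0)) (s : ℕ) : ∀ k, ∀ t ∈ Ici (0:ℝ),
    iteratedDerivWithin s (Pfun g (k+s)) (Ici 0) t = (-1)^s * Pfun g k t := by
  induction s with
  | zero => intro k t ht; simp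
  | succ s ih =>
    intro k t ht
    rw [iteratedDerivWithin_succ]
    have he : k + (s+1) = (k+1) + s := by omega
    rw [he, derivWithin_congr (ih (k+1)) (ih (k+1) t ht),
      (((aux_Pfun_deriv hg k t ht).const_mul ((-1:ℝ)^s)).derivWithin
        (uniqueDiffOn_Ici 0 t ht))]
    ring

lemma aux_Pfun_at_zero (g : ℝ → ℝ) (k : ℕ) : Pfun g (k+1) 0 = Acoef g k := by
  unfold Pfun
  rw [Fin.sum_univ_castSucc, Finset.sum_eq_zero]
  · simp [gk]
  · intro s _
    have : k + 1 - 1 - (s.castSucc).1 ≠ 0 := by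
      have := s.2
      simp; omega
    rw [zero_pow this]; simp

lemma aux_Acoef (g : ℝ → ℝ) (k : ℕ) : Acoef g k = ∫ t in Ioi (0:ℝ), Pfun g k t := by
  cases k with
  | zero => rw [aux_Pfun_zero, Acoef]
  | succ k => rw [Acoef]; rfl

lemma aux_Pfun_tail {g : ℝ → ℝ} (hg : ContinuousOn g (Ici 0)) (k : ℕ)
    (hi : IntegrableOn (Pfun g k) (Ioi 0)) (t : ℝ) (ht : 0 ≤ t) :
    ∫ x in Ioi t, Pfun g k x = Pfun g (k+1) t := by
  have hsub := intervalIntegral.integral_interval_add_Ioi hi (hi.mono_set (Ioi_subset_Ioi ht))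
  have hint : IntervalIntegrable (Pfun g k) volume 0 t :=
    (intervalIntegrable_iff_integrableOn_Ioc_of_le ht).2 (hi.mono_set Ioc_subset_Ioi_self)
  have h := intervalIntegral.integral_eq_sub_of_hasDerivAt_of_le ht
    (f := Pfun g (k+1)) (f' := fun x => - Pfun g k x)
    (fun x hx => ((aux_Pfun_deriv hg k x hx.1).continuousWithinAt).mono Icc_subset_Ici_self)
    (fun x hx => (aux_Pfun_deriv hg k x hx.1.le).hasDerivAt (Ici_mem_nhds hx.1)) hint.neg
  rw [intervalIntegral.integral_neg, aux_Pfun_at_zero, aux_Acoef] at h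
  linarith

lemma aux_tail {f p : ℝ → ℝ} {S : Set ℝ} (hS : S.Countable) (hf : ContinuousOn f (Ici 0))
    (hp : IntegrableOn p (Ioi 0))
    (hd : ∀ t, 0 < t → t ∉ S → ∃ d, HasDerivAt f d t ∧ |d| ≤ p t)
    (hL : ∀ L, Tendsto f atTop (𝓝 L) → L = 0) (t : ℝ) (ht : 0 ≤ t) :
    |f t| ≤ ∫ x in Ioi t, p x := by
  have hS0 : ∀ᵐ x ∂(volume : Measure ℝ), x ∉ S := hS.ae_notMem volume
  have hle : ∀ᵐ x ∂(volume.restrict (Ioi (0:ℝ))), ‖deriv f x‖ ≤ p x := by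
    filter_upwards [ae_restrict_of_ae hS0, ae_restrict_mem measurableSet_Ioi] with x hx hx0
    obtain ⟨d, hd1, hd2⟩ := hd x hx0 hx
    rw [hd1.deriv]; exact hd2
  have hi : IntegrableOn (deriv f) (Ioi 0) :=
    Integrable.mono' hp (measurable_deriv f).aestronglyMeasurable hle
  have hit := hi.mono_set (Ioi_subset_Ioi ht)
  have hpt := hp.mono_set (Ioi_subset_Ioi ht)
  have hlim := intervalIntegral_tendsto_integral_Ioi t hit tendsto_id
  have hFTC : ∀ b, t ≤ b → ∫ x in t..b, deriv f x = f b - f t := by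
    intro b hb
    apply integral_eq_of_hasDerivAt_off_countable_of_le f (deriv f) hb hS
    · exact hf.mono (fun x hx => ht.trans hx.1)
    · intro x hx
      obtain ⟨d, hd1, hd2⟩ := hd x (ht.trans_lt hx.1.1) hx.2
      rw [hd1.deriv]; exact hd1
    · exact (intervalIntegrable_iff_integrableOn_Ioc_of_le hb).2 (hit.mono_set Ioc_subset_Ioi_self)
  have hlim2 : Tendsto f atTop (𝓝 ((∫ x in Ioi t, deriv f x) + f t)) := by
    refine (hlim.add_const (f t)).congr' ?_
    filter_upwards [eventually_ge_atTop t] with b hb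
    have := hFTC b hb
    simp only [id]
    linarith
  have h0 := hL _ hlim2
  have : f t = - ∫ x in Ioi t, deriv f x := by linarith
  rw [this, abs_neg]
  calc |∫ x in Ioi t, deriv f x| ≤ ∫ x in Ioi t, ‖deriv f x‖ := by
        rw [← Real.norm_eq_abs]; exact norm_integral_le_integral_norm _
    _ ≤ _ := integral_mono_ae hit.norm hpt
      (ae_restrict_of_ae_restrict_of_subset (Ioi_subset_Ioi ht) hle)

lemma aux_grow {f f' : ℝ → ℝ} (hd : ∀ t, 0 < t → HasDerivAt f (f' t) t)
    (h : ∃ c > 0, ∀ᶠ t in atTop, c ≤ f' t) : ∃ c > 0, ∀ᶠ t in atTop, c ≤ f' t ∧ c ≤ f t := by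
  obtain ⟨c, hc, hev⟩ := h
  obtain ⟨T, hT⟩ := eventually_atTop.1 hev
  set T' := max T 1
  have hT'0 : 0 < T' := lt_of_lt_of_le one_pos (le_max_right _ _)
  have hm := (convex_Ici T').mul_sub_le_image_sub_of_le_deriv (f := f) (C := c)
    (fun x hx => (hd x (hT'0.trans_le hx)).continuousAt.continuousWithinAt)
    (fun x hx => by
      rw [interior_Ici] at hx
      exact (hd x (hT'0.trans hx)).differentiableAt.differentiableWithinAt)
    (fun x hx => by
      rw [interior_Ici] at hx
      rw [(hd x (hT'0.trans hx)).deriv]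
      exact hT x ((le_max_left T 1).trans (le_of_lt hx)))
  refine ⟨c, hc, ?_⟩
  filter_upwards [hev, eventually_ge_atTop T', eventually_ge_atTop ((c - f T')/c + T')] with t h1 h2 h3
  refine ⟨h1, ?_⟩
  have := hm T' self_mem_Ici t h2 h2
  have h4 : (c - f T')/c ≤ t - T' := by linarith
  rw [div_le_iff₀ hc] at h4
  linarith

lemma aux_unbdd {m : ℕ} : ∀ (q : ℕ → ℝ → ℝ),
    (∀ j < m, ∀ t, 0 < t → HasDerivAt (q j) (q (j+1) t) t) →
    (∃ c > 0, ∀ᶠ t in atTop, c ≤ q m t) → ∃ c > 0, ∀ᶠ t in atTop, c ≤ q 0 t := by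
  induction m with
  | zero => intro q _ h; exact h
  | succ m ih =>
    intro q hq h
    obtain ⟨c, hc, h'⟩ := aux_grow (hq m (by omega)) h
    exact ih q (fun j hj => hq j (by omega)) ⟨c, hc, h'.mono fun t ht => ht.2⟩

lemma aux_neg_limit {m : ℕ} (hm : 1 ≤ m) (q : ℕ → ℝ → ℝ)
    (hq : ∀ j < m, ∀ t, 0 < t → HasDerivAt (q j) (q (j+1) t) t)
    {C : ℝ} (hC : ∀ t, 0 ≤ t → |q 0 t| ≤ C) (L : ℝ) (hL : Tendsto (q m) atTop (𝓝 L)) :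
    ¬ 0 < L := by
  intro hpos
  obtain ⟨m, rfl⟩ : ∃ m', m = m' + 1 := ⟨m - 1, by omega⟩
  have h1 : ∃ c > 0, ∀ᶠ t in atTop, c ≤ q (m+1) t :=
    ⟨L/2, by linarith, hL.eventually_const_le (by linarith)⟩
  have h2 := aux_unbdd (m := m) (fun j => q (j+1)) (fun j hj => hq (j+1) (by omega)) h1
  simp only [zero_add] at h2
  obtain ⟨c, hc, hev⟩ := h2
  -- rescale to contradict the bound
  have hCC : 0 ≤ C := (abs_nonneg _).trans (hC 0 le_rfl)
  obtain ⟨T, hT⟩ := eventually_atTop.1 hev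
  set T' := max T 1
  have hT'0 : 0 < T' := lt_of_lt_of_le one_pos (le_max_right _ _)
  have hd := hq 0 (by omega)
  have hmm := (convex_Ici T').mul_sub_le_image_sub_of_le_deriv (f := q 0) (C := c)
    (fun x hx => (hd x (hT'0.trans_le hx)).continuousAt.continuousWithinAt)
    (fun x hx => by
      rw [interior_Ici] at hx
      exact (hd x (hT'0.trans hx)).differentiableAt.differentiableWithinAt)
    (fun x hx => by
      rw [interior_Ici] at hx
      rw [(hd x (hT'0.trans hx)).deriv]
      exact hT x ((le_max_left T 1).trans (le_of_lt hx)))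
  have hpos2 : 0 ≤ (2*C+1)/c := by positivity
  have h5 := hmm T' self_mem_Ici (T' + (2*C+1)/c) (by simp [hpos2]) (by linarith)
  have h6 : c * (T' + (2*C+1)/c - T') = 2*C+1 := by field_simp; ring
  have h7 := abs_le.1 (hC T' hT'0.le)
  have h8 := abs_le.1 (hC (T' + (2*C+1)/c) (by linarith))
  linarith [h7.1, h8.2]

lemma aux_limit {m : ℕ} (hm : 1 ≤ m) (q : ℕ → ℝ → ℝ)
    (hq : ∀ j < m, ∀ t, 0 < t → HasDerivAt (q j) (q (j+1) t) t)
    {C : ℝ} (hC : ∀ t, 0 ≤ t → |q 0 t| ≤ C) (L : ℝ) (hL : Tendsto (q m) atTop (𝓝 L)) :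
    L = 0 := by
  have h1 := aux_neg_limit hm q hq hC L hL
  have h2 := aux_neg_limit hm (fun j t => - q j t) (fun j hj t ht => (hq j hj t ht).neg)
    (C := C) (fun t ht => by rw [abs_neg]; exact hC t ht) (-L) hL.neg
  linarith

lemma aux_cover (u : ℕ → ℝ) (h0 : u 0 = 0) (t : ℝ) (ht : 0 < t) (n : ℕ)
    (hn : ∀ i ≤ n, t ≠ u i) : (∃ i < n, t ∈ Ioo (u i) (u (i+1))) ∨ u n < t := by
  induction n with
  | zero => right; rw [h0]; exact ht
  | succ n ih =>
    rcases ih (fun i hi => hn i (by omega)) with ⟨i, hi, h⟩ | h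
    · exact Or.inl ⟨i, by omega, h⟩
    · rcases lt_or_gt_of_ne (hn (n+1) le_rfl) with h' | h'
      · exact Or.inl ⟨n, by omega, h, h'⟩
      · exact Or.inr h'

lemma aux_local {U : Set ℝ} (hU : IsOpen U) {m : ℕ} {Q : ℝ → ℝ}
    (hQ : ContDiffOn ℝ (m+1 : ℕ) Q U) {t : ℝ} (ht : 0 < t) (htU : t ∈ U) :
    HasDerivAt (iteratedDerivWithin m Q (Ici 0)) (iteratedDerivWithin (m+1) Q U t) t := by
  have h1 : DifferentiableOn ℝ (iteratedDerivWithin m Q U) U :=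
    hQ.differentiableOn_iteratedDerivWithin (by exact_mod_cast Nat.lt_succ_self m)
      hU.uniqueDiffOn
  have h2 := (h1 t htU).hasDerivWithinAt
  rw [← iteratedDerivWithin_succ] at h2
  have h3 := h2.hasDerivAt (hU.mem_nhds htU)
  refine h3.congr_of_eventuallyEq ?_
  filter_upwards [hU.mem_nhds htU, Ioi_mem_nhds ht] with y hy hy0
  unfold iteratedDerivWithin
  rw [iteratedFDerivWithin_congr_set]
  filter_upwards [hU.mem_nhds hy, Ioi_mem_nhds hy0] with z hz hz0
  exact propext ⟨fun _ => hz, fun _ => le_of_lt hz0⟩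

lemma aux_knot {g : ℝ → ℝ} (hg_pos : ∀ t ∈ Ici (0:ℝ), 0 < g t) {m n : ℕ} {u : ℕ → ℝ} {ε : ℝ}
    {Q : ℝ → ℝ} (hQ : PerfectSplineInf g (m+1) n u ε Q) (t : ℝ) (ht : 0 < t)
    (hn : t ∉ u '' Iic n) :
    ∃ d, HasDerivAt (iteratedDerivWithin m Q (Ici 0)) d t ∧ |d| = g t := by
  obtain ⟨hε, h0, -, -, h1, h2, h3⟩ := hQ
  have habs : ∀ i : ℕ, |ε * (-1:ℝ)^i * g t| = g t := by
    intro i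
    rw [abs_mul, abs_mul, abs_pow, abs_of_pos (hg_pos t ht.le)]
    rcases hε with rfl | rfl <;> simp
  rcases aux_cover u h0 t ht n (fun i hi h => hn ⟨i, hi, h.symm⟩) with ⟨i, hi, h⟩ | h
  · refine ⟨_, aux_local isOpen_Ioo (h1 i hi).1 ht h, ?_⟩
    rw [(h1 i hi).2 t h]; exact habs i
  · refine ⟨_, aux_local isOpen_Ioi h2 ht h, ?_⟩
    rw [h3 t h]; exact habs n

/-- Lemma 7: a bounded perfect g-spline Q of order r on [0,∞) with finitely many
knots satisfies |Q^{(s)}(t)| ≤ |P_r^{(s)}(t)| for all t ≥ 0 and s = 1, …, r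
(almost everywhere in the case s = r). -/
theorem statement15
    (g : ℝ → ℝ)
    (hg_c : ContinuousOn g (Ici 0)) (hg_pos : ∀ t ∈ Ici (0:ℝ), 0 < g t)
    (hg_anti : AntitoneOn g (Ici 0))
    (r : ℕ) (hr : 1 ≤ r) (h6 : Cond6 g r)
    (n : ℕ) (u : ℕ → ℝ) (ε : ℝ) (Q : ℝ → ℝ)
    (hQ : PerfectSplineInf g r n u ε Q)
    (hbdd : ∃ C, ∀ t ∈ Ici (0:ℝ), |Q t| ≤ C) :
    (∀ s, 1 ≤ s → s < r → ∀ t ∈ Ici (0:ℝ),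
      |iteratedDerivWithin s Q (Ici 0) t| ≤ |iteratedDerivWithin s (Pfun g r) (Ici 0) t|) ∧
    (∀ᵐ t ∂(volume.restrict (Ici (0:ℝ))),
      |iteratedDerivWithin r Q (Ici 0) t| ≤ |iteratedDerivWithin r (Pfun g r) (Ici 0) t|) := by
  obtain ⟨m, rfl⟩ : ∃ m, r = m + 1 := ⟨r - 1, by omega⟩
  obtain ⟨C, hC⟩ := hbdd
  have hknot := aux_knot hg_pos hQ
  have hScount : (u '' Iic n).Countable := ((finite_Iic n).image u).countable
  have hcd : ContDiffOn ℝ (m : ℕ) Q (Ici 0) := by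
    have := hQ.2.2.2.1
    simpa using this
  have hint : ∀ k ≤ m, IntegrableOn (Pfun g k) (Ioi 0) := by
    intro k hk
    rcases Nat.eq_zero_or_pos k with rfl | hk0
    · rw [aux_Pfun_zero]; exact h6.1
    · exact h6.2 k hk0 (by simpa using hk)
  have hq : ∀ j < m, ∀ t, 0 < t → HasDerivAt (iteratedDerivWithin j Q (Ici 0))
      (iteratedDerivWithin (j+1) Q (Ici 0) t) t := by
    intro j hj t ht
    have h1 := hcd.differentiableOn_iteratedDerivWithin (m := j) (by exact_mod_cast hj)
      (uniqueDiffOn_Ici 0)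
    have h2 := (h1 t ht.le).hasDerivWithinAt
    rw [← iteratedDerivWithin_succ] at h2
    exact h2.hasDerivAt (Ici_mem_nhds ht)
  have hcont : ∀ j ≤ m, ContinuousOn (iteratedDerivWithin j Q (Ici 0)) (Ici 0) := fun j hj =>
    hcd.continuousOn_iteratedDerivWithin (by exact_mod_cast hj) (uniqueDiffOn_Ici 0)
  have hlim : ∀ j, 1 ≤ j → j ≤ m → ∀ L,
      Tendsto (iteratedDerivWithin j Q (Ici 0)) atTop (𝓝 L) → L = 0 := by
    intro j hj hjm L hL
    exact aux_limit hj (fun j => iteratedDerivWithin j Q (Ici 0))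
      (fun i hi => hq i (by omega)) (C := C) (fun t ht => by simpa using hC t ht) L hL
  have key : ∀ k j, j + k = m → 1 ≤ j → ∀ t, 0 ≤ t →
      |iteratedDerivWithin j Q (Ici 0) t| ≤ Pfun g (k+1) t := by
    intro k
    induction k with
    | zero =>
      intro j hjk hj t ht
      obtain rfl : j = m := by omega
      rw [← aux_Pfun_tail hg_c 0 (hint 0 (by omega)) t ht]
      refine aux_tail hScount (hcont j le_rfl) (hint 0 (by omega)) ?_ (hlim j hj le_rfl) t ht
      intro t ht hS
      obtain ⟨d, h1, h2⟩ := hknot t ht hS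
      exact ⟨d, h1, by rw [aux_Pfun_zero]; exact h2.le⟩
    | succ k ih =>
      intro j hjk hj t ht
      rw [← aux_Pfun_tail hg_c (k+1) (hint (k+1) (by omega)) t ht]
      refine aux_tail countable_empty (hcont j (by omega)) (hint (k+1) (by omega)) ?_
        (hlim j hj (by omega)) t ht
      intro t ht _
      exact ⟨_, hq j (by omega) t ht, ih (j+1) (by omega) (by omega) t ht.le⟩
  constructor
  · intro s hs hsr t ht
    have h1 := key (m - s) s (by omega) hs t ht
    have h2 := aux_Pfun_iter hg_c s (m - s + 1) t ht
    have h3 : m - s + 1 + s = m + 1 := by omega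
    rw [h3] at h2
    rw [h2, abs_mul, abs_pow]
    simp only [abs_neg, abs_one, one_pow, one_mul]
    exact h1.trans (le_abs_self _)
  · have hne : ∀ᵐ x ∂(volume : Measure ℝ), x ∉ u '' Iic n := hScount.ae_notMem volume
    have hne0 : ∀ᵐ x ∂(volume : Measure ℝ), x ∉ ({0} : Set ℝ) :=
      (countable_singleton 0).ae_notMem volume
    filter_upwards [ae_restrict_of_ae hne, ae_restrict_of_ae hne0,
      ae_restrict_mem measurableSet_Ici] with t h1 h2 h3
    have ht : 0 < t := lt_of_le_of_ne h3 (fun h => h2 h.symm)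
    obtain ⟨d, hd1, hd2⟩ := hknot t ht h1
    have h4 := aux_Pfun_iter hg_c (m+1) 0 t h3
    rw [zero_add, aux_Pfun_zero] at h4
    rw [h4, iteratedDerivWithin_succ, hd1.hasDerivWithinAt.derivWithin (uniqueDiffOn_Ici 0 t h3),
      hd2, abs_mul, abs_pow]
    simp only [abs_neg, abs_one, one_pow, one_mul]
    exact le_abs_self _
end

section
/- Let f and g be continuous, positive, non-increasing functions on [0,∞), let r ∈ ℕ, assume φ_{r,0,f}(∞) < ∞ and f(t)/|P_r(t)| → ∞ as t → ∞. Fix n ∈ ℕ. Suppose M_k → ∞ is a sequence and P : [0,∞) → ℝ is a function such that the splines G_{r,n,f,M_k} converge to P uniformly on every compact subset of [0,∞). Then P has at least n−1 oscillation points, i.e., there exist at least n−1 distinct points t ∈ [0,∞) with |P(t)| = φ_{r,n,f}(∞)·f(t). -/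
open Set Filter MeasureTheory
open scoped Topology

def Chn (k : ℕ) (D : ℕ → ℝ → ℝ) (α β : ℝ) : Prop :=
  (∀ j ≤ k, ContinuousOn (D j) (Icc α β)) ∧
  ∀ j < k, ∀ t ∈ Ioo α β, HasDerivAt (D j) (D (j + 1) t) t

lemma Chn.sub {k : ℕ} {D E : ℕ → ℝ → ℝ} {α β : ℝ} (hD : Chn k D α β) (hE : Chn k E α β) :
    Chn k (fun j t => D j t - E j t) α β :=
  ⟨fun j hj => (hD.1 j hj).sub (hE.1 j hj), fun j hj t ht => (hD.2 j hj t ht).sub (hE.2 j hj t ht)⟩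

lemma Chn.smul {k : ℕ} {D : ℕ → ℝ → ℝ} {α β : ℝ} (c : ℝ) (hD : Chn k D α β) :
    Chn k (fun j t => c * D j t) α β :=
  ⟨fun j hj => continuousOn_const.mul (hD.1 j hj), fun j hj t ht => (hD.2 j hj t ht).const_mul c⟩

lemma Chn.mono {k : ℕ} {D : ℕ → ℝ → ℝ} {α β α' β' : ℝ} (hD : Chn k D α β)
    (h1 : α ≤ α') (h2 : β' ≤ β) : Chn k D α' β' :=
  ⟨fun j hj => (hD.1 j hj).mono (Icc_subset_Icc h1 h2),
   fun j hj t ht => hD.2 j hj t (Ioo_subset_Ioo h1 h2 ht)⟩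

lemma rolle_alt (α β : ℝ) (N : ℕ) : ∀ (k s : ℕ) (D : ℕ → ℝ → ℝ), Chn k D α β →
    ∀ b : ℕ → ℝ, (∀ i, i + 1 < N + k → b i < b (i + 1)) → (∀ i < N + k, b i ∈ Icc α β) →
    (∀ i < N + k, 0 < (-1 : ℝ) ^ (i + s) * D 0 (b i)) →
    ∃ c : ℕ → ℝ, (∀ i, i + 1 < N → c i < c (i + 1)) ∧ (∀ i < N, c i ∈ Icc α β) ∧
      ∀ i < N, 0 < (-1 : ℝ) ^ (i + s + k) * D k (c i) := by
  intro k
  induction k with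
  | zero => intro s D _ b h1 h2 h3; exact ⟨b, h1, h2, h3⟩
  | succ k ih =>
    intro s D hD b h1 h2 h3
    have key : ∀ i, ∃ c, i < N + k → c ∈ Ioo (b i) (b (i + 1)) ∧
        0 < (-1 : ℝ) ^ (i + (s + 1)) * D 1 c := by
      intro i
      by_cases hi : i < N + k
      swap
      · exact ⟨0, fun h => absurd h hi⟩
      have hlt := h1 i (by omega)
      have m1 := h2 i (by omega)
      have m2 := h2 (i + 1) (by omega)
      obtain ⟨c, hc, hce⟩ := exists_hasDerivAt_eq_slope (D 0) (D 1) hlt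
        ((hD.1 0 (by omega)).mono (Icc_subset_Icc m1.1 m2.2))
        (fun x hx => hD.2 0 (by omega) x ⟨lt_of_le_of_lt m1.1 hx.1, lt_of_lt_of_le hx.2 m2.2⟩)
      refine ⟨c, fun _ => ⟨hc, ?_⟩⟩
      rw [hce, ← mul_div_assoc]
      apply div_pos _ (sub_pos.2 hlt)
      have e1 := h3 i (by omega)
      have e2 := h3 (i + 1) (by omega)
      have : (-1 : ℝ) ^ (i + 1 + s) = - (-1 : ℝ) ^ (i + s) := by
        rw [show i + 1 + s = i + s + 1 by ring, pow_succ]; ring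
      rw [this] at e2
      rw [show i + (s + 1) = i + s + 1 by ring, pow_succ]
      nlinarith
    choose c hc using key
    obtain ⟨d, d1, d2, d3⟩ := ih (s + 1) (fun j => D (j + 1))
      ⟨fun j hj => hD.1 (j + 1) (by omega), fun j hj => hD.2 (j + 1) (by omega)⟩ c
      (fun i hi => ((hc i (by omega)).1.2).trans (hc (i + 1) (by omega)).1.1)
      (fun i hi => ⟨(h2 i (by omega)).1.trans (hc i hi).1.1.le,
        (hc i hi).1.2.le.trans (h2 (i + 1) (by omega)).2⟩)
      (fun i hi => (hc i hi).2)
    refine ⟨d, d1, d2, fun i hi => ?_⟩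
    have := d3 i hi
    rwa [show i + s + (k + 1) = i + (s + 1) + k by ring]

lemma core_alt (y : ℝ → ℝ) (m n : ℕ) (hmn : m ≤ n) (u c : ℕ → ℝ)
    (hp : ∀ i ≤ m, ∀ s ∈ Icc (u i) (u (i + 1)), ∀ t ∈ Icc (u i) (u (i + 1)), s ≤ t →
      (-1 : ℝ) ^ i * (y t - y s) ≤ 0)
    (hc : ∀ i, i + 1 < n + 2 → c i < c (i + 1))
    (hcm : ∀ i < n + 2, c i ∈ Icc (u 0) (u (m + 1)))
    (hs : ∀ i < n + 2, 0 < (-1 : ℝ) ^ (i + 1) * y (c i)) : False := by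
  have step : ∀ i ≤ m, u i ≤ c i → u (i + 1) < c (i + 1) := by
    intro i hi hle
    by_contra hcon
    push Not at hcon
    have hlt := hc i (by omega)
    have := hp i hi (c i) ⟨hle, by linarith⟩ (c (i + 1)) ⟨by linarith, hcon⟩ hlt.le
    have e1 := hs i (by omega)
    have e2 := hs (i + 1) (by omega)
    rw [pow_succ] at e1
    rw [pow_succ, pow_succ] at e2
    nlinarith
  have all : ∀ i ≤ m, u i ≤ c i := by
    intro i
    induction i with
    | zero => intro _; exact (hcm 0 (by omega)).1
    | succ i ih => intro hi; exact (step i (by omega) (ih (by omega))).le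
  have := step m le_rfl (all m le_rfl)
  have h2 := (hcm (m + 1) (by omega)).2
  linarith

lemma orient (γ : ℝ → ℝ) (r n m : ℕ) (hr : 1 ≤ r) (a : ℝ) (hmn : m ≤ n) (u : ℕ → ℝ) (ε : ℝ)
    (hε : ε = 1 ∨ ε = -1) (hu0 : u 0 = 0) (hum : u (m + 1) = a)
    (hum2 : ∀ i ≤ m, 0 ≤ u i ∧ u (i + 1) ≤ a)
    (D E : ℕ → ℝ → ℝ) (hD : Chn (r - 1) D 0 a) (hE : Chn (r - 1) E 0 a)
    (hDp : ∀ i ≤ m, ∀ s ∈ Icc (u i) (u (i + 1)), ∀ t ∈ Icc (u i) (u (i + 1)), 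
      D (r - 1) t - D (r - 1) s = ε * (-1 : ℝ) ^ i * (γ t - γ s))
    (hEp : ∀ s ∈ Icc 0 a, ∀ t ∈ Icc 0 a, s ≤ t → |E (r - 1) t - E (r - 1) s| ≤ γ t - γ s)
    (b : ℕ → ℝ) (hb : ∀ i, i + 1 < n + r + 1 → b i < b (i + 1))
    (hbm : ∀ i < n + r + 1, b i ∈ Icc 0 a)
    (hs : ∀ i < n + r + 1, 0 < (-1 : ℝ) ^ (i + r) * (D 0 (b i) - E 0 (b i))) : ε = 1 := by
  rcases hε with h | h
  · exact h
  exfalso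
  have hN : n + 2 + (r - 1) = n + r + 1 := by omega
  obtain ⟨c, c1, c2, c3⟩ := rolle_alt 0 a (n + 2) (r - 1) r _ (hD.sub hE) b
    (by rw [hN]; exact hb) (by rw [hN]; exact hbm) (by rw [hN]; exact hs)
  refine core_alt (fun t => D (r - 1) t - E (r - 1) t) m n hmn u c ?_ c1 
    (by rw [hu0, hum]; exact c2) ?_
  · intro i hi s hs t ht hst
    have h1 := hDp i hi s hs t ht
    have h2 := abs_le.1 (hEp s ⟨(hum2 i hi).1.trans hs.1, hs.2.trans (hum2 i hi).2⟩ t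
      ⟨(hum2 i hi).1.trans ht.1, ht.2.trans (hum2 i hi).2⟩ hst)
    subst h
    rcases neg_one_pow_eq_or ℝ i with e | e <;> rw [e] at h1 ⊢ <;> linarith [h2.1, h2.2]
  · intro i hi
    have := c3 i hi
    rwa [show i + r + (r - 1) = i + 1 + 2 * (r - 1) by omega, pow_add, pow_mul, neg_one_sq,
      one_pow, mul_one] at this

section
variable {g : ℝ → ℝ} (hg_c : ContinuousOn g (Ici 0)) (hg_pos : ∀ t ∈ Ici (0:ℝ), 0 < g t)

lemma gk_cont (hg_c : ContinuousOn g (Ici 0)) : ∀ k, ContinuousOn (gk g k) (Ici 0)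
  | 0 => hg_c
  | k + 1 => by
    intro t ht
    have ih := gk_cont hg_c k
    have hi : IntegrableOn (gk g k) (uIcc 0 (t + 1)) := by
      rw [uIcc_of_le (by linarith [mem_Ici.1 ht])]
      exact (ih.mono Icc_subset_Ici_self).integrableOn_Icc
    have := intervalIntegral.continuousOn_primitive_interval hi t
      (by rw [uIcc_of_le (by linarith [mem_Ici.1 ht])]; exact ⟨ht, by linarith⟩)
    rw [uIcc_of_le (by linarith [mem_Ici.1 ht])] at this
    refine this.mono_of_mem_nhdsWithin ?_
    rw [← Ici_inter_Iic]
    exact inter_mem_nhdsWithin _ (Iic_mem_nhds (by linarith))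

lemma gk_deriv (hg_c : ContinuousOn g (Ici 0)) (k : ℕ) {t : ℝ} (ht : 0 < t) :
    HasDerivAt (gk g (k + 1)) (gk g k t) t := by
  have ih := gk_cont hg_c k
  refine intervalIntegral.integral_hasDerivAt_right ?_ ?_ (ih.continuousAt (Ici_mem_nhds ht))
  · refine ContinuousOn.intervalIntegrable ?_
    rw [uIcc_of_le ht.le]
    exact ih.mono Icc_subset_Ici_self
  · exact (ih.mono Ioi_subset_Ici_self).stronglyMeasurableAtFilter isOpen_Ioi _ ht

lemma Pfun_cont (hg_c : ContinuousOn g (Ici 0)) (k : ℕ) : ContinuousOn (Pfun g k) (Ici 0) := by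
  unfold Pfun
  exact (Continuous.continuousOn (by fun_prop)).add (continuousOn_const.mul (gk_cont hg_c k))

lemma Pfun_deriv (hg_c : ContinuousOn g (Ici 0)) (k : ℕ) {t : ℝ} (ht : 0 < t) :
    HasDerivAt (Pfun g (k + 1)) (- Pfun g k t) t := by
  unfold Pfun
  have h2 := (gk_deriv hg_c k ht).const_mul ((-1 : ℝ) ^ (k + 1))
  have h1 : HasDerivAt (fun t : ℝ => ∑ s : Fin (k + 1), (-1 : ℝ) ^ (k + 1 - 1 - s.1) * Acoef g s.1 *
      t ^ (k + 1 - 1 - s.1) / (Nat.factorial (k + 1 - 1 - s.1) : ℝ))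
      (- ∑ s : Fin k, (-1 : ℝ) ^ (k - 1 - s.1) * Acoef g s.1 * t ^ (k - 1 - s.1) /
    (Nat.factorial (k - 1 - s.1) : ℝ)) t := by
    have := HasDerivAt.fun_sum (u := (Finset.univ : Finset (Fin (k + 1)))) (x := t)
      (A := fun s t => (-1 : ℝ) ^ (k - s.1) * Acoef g s.1 *
        t ^ (k - s.1) / (Nat.factorial (k - s.1) : ℝ)) 
      (fun s _ => ((hasDerivAt_pow (k - s.1) t).const_mul 
        ((-1 : ℝ) ^ (k - s.1) * Acoef g s.1)).div_const _)
    refine this.congr_deriv ?_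
    rw [Fin.sum_univ_castSucc, ← Finset.sum_neg_distrib]
    simp only [Fin.val_castSucc, Fin.val_last, Nat.sub_self]
    simp only [Nat.cast_zero, zero_mul, mul_zero, zero_div, add_zero]
    refine Finset.sum_congr rfl fun s _ => ?_
    obtain ⟨j, hj⟩ : ∃ j, k - s.1 = j + 1 := ⟨k - s.1 - 1, by have := s.2; omega⟩
    rw [show k - 1 - s.1 = j by omega, hj, Nat.factorial_succ, pow_succ]
    have : (Nat.factorial j : ℝ) ≠ 0 := by positivity
    push_cast
    field_simp
  refine (h1.add h2).congr_deriv ?_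
  rw [pow_succ]; ring

lemma gk1_mono (hg_c : ContinuousOn g (Ici 0)) (hg_pos : ∀ t ∈ Ici (0:ℝ), 0 < g t) :
    MonotoneOn (gk g 1) (Ici 0) := by
  refine monotoneOn_of_hasDerivWithinAt_nonneg (convex_Ici 0) (gk_cont hg_c 1) (f' := g) ?_ ?_
  · intro x hx
    rw [interior_Ici] at hx
    exact (gk_deriv hg_c 0 hx).hasDerivWithinAt
  · intro x hx
    exact (hg_pos x (interior_subset hx)).le

lemma u_mono {m : ℕ} {u : ℕ → ℝ} (h : ∀ i ≤ m, u i < u (i + 1)) :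
    ∀ i ≤ m + 1, ∀ j ≤ i, u j ≤ u i := by
  intro i
  induction i with
  | zero => intro _ j hj; rw [Nat.le_zero.1 hj]
  | succ i ih =>
    intro hi j hj
    rcases Nat.lt_or_ge j (i + 1) with h' | h'
    · exact (ih (by omega) j (by omega)).trans (h i (by omega)).le
    · rw [le_antisymm hj h']

lemma spline_chain {r : ℕ} {a : ℝ} (ha : 0 < a) {G : ℝ → ℝ}
    (h : ContDiffOn ℝ (r - 1 : ℕ) G (Icc 0 a)) :
    Chn (r - 1) (fun j => iteratedDerivWithin j G (Icc 0 a)) 0 a := by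
  have hu := uniqueDiffOn_Icc ha
  refine ⟨fun j hj => h.continuousOn_iteratedDerivWithin (by exact_mod_cast hj) hu, ?_⟩
  intro j hj t ht
  have hd := h.differentiableOn_iteratedDerivWithin (m := j) (by exact_mod_cast hj) hu t
    (Ioo_subset_Icc_self ht)
  have := hd.hasDerivWithinAt.hasDerivAt (Icc_mem_nhds ht.1 ht.2)
  rwa [← iteratedDerivWithin_succ] at this

lemma spline_facts {r : ℕ} (hr : 1 ≤ r) {a : ℝ} {m : ℕ} {u : ℕ → ℝ} {ε : ℝ} {G : ℝ → ℝ}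
    (hg_c : ContinuousOn g (Ici 0)) (hg_pos : ∀ t ∈ Ici (0:ℝ), 0 < g t)
    (h : PerfectSplineWith g r a m u ε G) :
    (∀ i ≤ m, 0 ≤ u i ∧ u (i + 1) ≤ a) ∧
    (∀ i ≤ m, ∀ s ∈ Icc (u i) (u (i + 1)), ∀ t ∈ Icc (u i) (u (i + 1)), 
      iteratedDerivWithin (r - 1) G (Icc 0 a) t - iteratedDerivWithin (r - 1) G (Icc 0 a) s
        = ε * (-1 : ℝ) ^ i * (gk g 1 t - gk g 1 s)) ∧
    (∀ s ∈ Icc 0 a, ∀ t ∈ Icc 0 a, s ≤ t → 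
      |iteratedDerivWithin (r - 1) G (Icc 0 a) t - iteratedDerivWithin (r - 1) G (Icc 0 a) s|
        ≤ gk g 1 t - gk g 1 s) := by
  obtain ⟨hε, hu0, hum, hu, hG, hp⟩ := h
  have hmono := u_mono hu
  have hin : ∀ i ≤ m, 0 ≤ u i ∧ u (i + 1) ≤ a := fun i hi =>
    ⟨hu0 ▸ hmono i (by omega) 0 (by omega), hum ▸ hmono (m + 1) le_rfl (i + 1) (by omega)⟩
  have ha : 0 < a := by
    have h1 := hu 0 (by omega)
    have h2 := (hin 0 (by omega)).2
    linarith [hu0]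
  have hch := spline_chain ha hG
  set hh := iteratedDerivWithin (r - 1) G (Icc 0 a) with hhdef
  have hcont : ContinuousOn hh (Icc 0 a) := hch.1 (r - 1) le_rfl
  have hder : ∀ i ≤ m, ∀ t ∈ Ioo (u i) (u (i + 1)), HasDerivAt hh (ε * (-1 : ℝ) ^ i * g t) t := by
    intro i hi t ht
    obtain ⟨hc, hv⟩ := hp i hi
    have hsub : Ioo (u i) (u (i + 1)) ⊆ Ioo 0 a := Ioo_subset_Ioo (hin i hi).1 (hin i hi).2
    have hd := hc.differentiableOn_iteratedDerivWithin (m := r - 1)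
      (by exact_mod_cast (by omega : r - 1 < r)) (isOpen_Ioo.uniqueDiffOn) t ht
    have h1 := hd.hasDerivWithinAt.hasDerivAt (Ioo_mem_nhds ht.1 ht.2)
    rw [← iteratedDerivWithin_succ, show r - 1 + 1 = r by omega, hv t ht] at h1
    refine h1.congr_of_eventuallyEq ?_
    filter_upwards [Ioo_mem_nhds ht.1 ht.2] with x hx
    rw [hhdef, iteratedDerivWithin_of_isOpen isOpen_Ioo hx, 
      ← iteratedDerivWithin_of_isOpen isOpen_Ioo (hsub hx)]
    unfold iteratedDerivWithin
    congr 1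
    refine iteratedFDerivWithin_congr_set ?_ _
    have hx' := hsub hx
    filter_upwards [Ioo_mem_nhds hx'.1 hx'.2] with z hz
    exact propext ⟨fun _ => hz, fun _ => Ioo_subset_Icc_self hz⟩
  have hpiece : ∀ i ≤ m, ∀ s ∈ Icc (u i) (u (i + 1)), ∀ t ∈ Icc (u i) (u (i + 1)), 
      hh t - hh s = ε * (-1 : ℝ) ^ i * (gk g 1 t - gk g 1 s) := by
    intro i hi s hs t ht
    have hsub : Icc (u i) (u (i + 1)) ⊆ Icc 0 a := Icc_subset_Icc (hin i hi).1 (hin i hi).2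
    have key : ∀ x ∈ Icc (u i) (u (i + 1)), 
        hh x - ε * (-1 : ℝ) ^ i * gk g 1 x = 
        hh (u i) - ε * (-1 : ℝ) ^ i * gk g 1 (u i) := by
      intro x hx
      rcases eq_or_lt_of_le hx.1 with e | hlt
      · rw [← e]
      obtain ⟨c, hc, hce⟩ := exists_hasDerivAt_eq_slope 
        (fun x => hh x - ε * (-1 : ℝ) ^ i * gk g 1 x) (fun _ => 0) hlt 
        (((hcont.mono hsub).sub (continuousOn_const.mul ((gk_cont hg_c 1).mono
          (hsub.trans Icc_subset_Ici_self)))).mono (Icc_subset_Icc_right hx.2))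
        (by
          intro z hz
          have hz' : z ∈ Ioo (u i) (u (i + 1)) := ⟨hz.1, hz.2.trans_le hx.2⟩
          have := (hder i hi z hz').sub 
            ((gk_deriv hg_c 0 (lt_of_le_of_lt (hin i hi).1 hz.1)).const_mul (ε * (-1 : ℝ) ^ i))
          refine this.congr_deriv ?_
          simp [gk])
      have := (div_eq_zero_iff.1 hce.symm).resolve_right (by linarith)
      linarith
    have k1 := key s hs
    have k2 := key t ht
    linarith
  refine ⟨hin, hpiece, ?_⟩
  have hγ := gk1_mono hg_c hg_pos
  have hpc : ∀ i ≤ m, ∀ s ∈ Icc (u i) (u (i + 1)), ∀ t ∈ Icc (u i) (u (i + 1)), s ≤ t →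
      |hh t - hh s| ≤ gk g 1 t - gk g 1 s := by
    intro i hi s hs t ht hst
    rw [hpiece i hi s hs t ht, abs_mul, abs_mul, abs_pow, abs_neg, abs_one, one_pow]
    have : |ε| = 1 := by rcases hε with e | e <;> simp [e]
    rw [this, abs_of_nonneg]
    · linarith
    · have h0 := (hin i hi).1
      exact sub_nonneg.2 (hγ (h0.trans hs.1) (h0.trans ht.1) hst)
  have glue : ∀ j ≤ m + 1, ∀ s ∈ Icc 0 (u j), ∀ t ∈ Icc 0 (u j), s ≤ t →
      |hh t - hh s| ≤ gk g 1 t - gk g 1 s := by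
    intro j
    induction j with
    | zero => 
      intro _ s hs t ht hst
      rw [hu0] at hs ht
      have : s = t := le_antisymm hst (ht.2.trans hs.1)
      simp [this]
    | succ j ih =>
      intro hj s hs t ht hst
      have hj0 := (hin j (by omega)).1
      have hjj := (hu j (by omega)).le
      rcases le_total t (u j) with h1 | h1
      · exact ih (by omega) s ⟨hs.1, hst.trans h1⟩ t ⟨ht.1, h1⟩ hst
      rcases le_total (u j) s with h2 | h2
      · exact hpc j (by omega) s ⟨h2, hs.2⟩ t ⟨h1, ht.2⟩ hst
      have k1 := ih (by omega) s ⟨hs.1, h2⟩ (u j) ⟨hj0, le_rfl⟩ h2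
      have k2 := hpc j (by omega) (u j) ⟨le_rfl, hjj⟩ t ⟨h1, ht.2⟩ h1
      have := abs_sub_le (hh t) (hh (u j)) (hh s)
      linarith
  have := glue (m + 1) le_rfl
  rwa [hum] at this

end

lemma wNorm_bound {f G : ℝ → ℝ} {a : ℝ} (hf_c : ContinuousOn f (Ici 0))
    (hf_pos : ∀ t ∈ Ici (0:ℝ), 0 < f t) (hG : ContinuousOn G (Icc 0 a)) :
    ∀ t ∈ Icc 0 a, |G t| ≤ wNorm G f (Icc 0 a) * f t := by
  intro t ht
  have hc : ContinuousOn (fun t => |G t| / f t) (Icc 0 a) :=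
    hG.abs.div (hf_c.mono Icc_subset_Ici_self) fun x hx => (hf_pos x hx.1).ne'
  have := le_csSup (isCompact_Icc.image_of_continuousOn hc).bddAbove (mem_image_of_mem _ ht)
  exact (div_le_iff₀ (hf_pos t ht.1)).1 this

lemma osc_facts {f G : ℝ → ℝ} {r n : ℕ} {a : ℝ} (h : HasOsc f r n a G) :
    ∃ b : ℕ → ℝ, (∀ i, i + 1 < n + r + 1 → b i < b (i + 1)) ∧ 
      (∀ i < n + r + 1, b i ∈ Icc 0 a) ∧
      ∀ i < n + r + 1, G (b i) = (-1 : ℝ) ^ (i + r) * (wNorm G f (Icc 0 a) * f (b i)) := by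
  obtain ⟨b, b0, ba, bm, bv⟩ := h
  refine ⟨fun i => b (i + 1), fun i hi => bm (i + 1) (by omega) (by omega), ?_, ?_⟩
  · have hm : ∀ i < n + r + 1, ∀ j ≤ i, b (j + 1) ≤ b (i + 1) := by
      intro i
      induction i with
      | zero => intro _ j hj; rw [Nat.le_zero.1 hj]
      | succ i ih =>
        intro hi j hj
        rcases Nat.lt_or_ge j (i + 1) with h' | h'
        · exact (ih (by omega) j (by omega)).trans (bm (i + 1) (by omega) (by omega)).le
        · rw [le_antisymm hj h']
    intro i hi
    exact ⟨b0.trans (hm i hi 0 (by omega)), ba ▸ hm (n + r) (by omega) i (by omega)⟩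
  · intro i hi
    rw [bv (i + 1) (by omega) (by omega), show i + 1 + r + 1 = i + r + 2 by ring, pow_add]
    norm_num

lemma neg_pow_sq (i : ℕ) : (-1 : ℝ) ^ i * (-1 : ℝ) ^ i = 1 := by
  rw [← pow_add, ← two_mul, pow_mul]; norm_num

lemma wNorm_pos {f g G : ℝ → ℝ} {r n : ℕ} {a : ℝ} (hf_c : ContinuousOn f (Ici 0))
    (hf_pos : ∀ t ∈ Ici (0:ℝ), 0 < f t) (hg_pos : ∀ t ∈ Ici (0:ℝ), 0 < g t)
    (h : InGamma g r n a G) : 0 < wNorm G f (Icc 0 a) := by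
  obtain ⟨m, hm, u, ε, hε, hu0, hum, hu, hG, hp⟩ := h
  by_contra hcon
  push Not at hcon
  have hb := wNorm_bound hf_c hf_pos hG.continuousOn
  have hz : ∀ t ∈ Icc 0 a, G t = 0 := by
    intro t ht
    have h1 := hb t ht
    have h2 := hf_pos t ht.1
    have h3 := abs_nonneg (G t)
    exact abs_eq_zero.1 (le_antisymm (by nlinarith) h3)
  have h01 := hu 0 (by omega)
  obtain ⟨s, hs⟩ := exists_between h01
  have h1a : u 1 ≤ a := hum ▸ u_mono hu (m + 1) le_rfl 1 (by omega)
  have e := (hp 0 (by omega)).2 s hs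
  have : iteratedDerivWithin r G (Ioo (u 0) (u (0 + 1))) s = 
      iteratedDerivWithin r (fun _ => (0:ℝ)) (Ioo (u 0) (u (0 + 1))) s := by
    refine iteratedDerivWithin_congr (fun x hx => ?_) hs
    exact hz x ⟨by linarith [hx.1], by linarith [hx.2]⟩
  rw [this] at e
  have hgs := hg_pos s (by rw [mem_Ici]; linarith [hs.1])
  have h0 : iteratedDerivWithin r (fun _ => (0:ℝ)) (Ioo (u 0) (u (0 + 1))) s = 0 := by
    simp
  rw [h0] at e
  rcases hε with e' | e' <;> rw [e'] at e <;> simp at e <;> linarith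

lemma wNorm_unique_aux {f g : ℝ → ℝ} {r n : ℕ} (hr : 1 ≤ r) {a : ℝ} (ha : 0 < a) {G H : ℝ → ℝ}
    (hf_c : ContinuousOn f (Ici 0)) (hf_pos : ∀ t ∈ Ici (0:ℝ), 0 < f t)
    (hg_c : ContinuousOn g (Ici 0)) (hg_pos : ∀ t ∈ Ici (0:ℝ), 0 < g t)
    (hG : IsExtremalSpline f g r n a G) (hH : IsExtremalSpline f g r n a H) :
    wNorm H f (Icc 0 a) ≤ wNorm G f (Icc 0 a) := by
  by_contra hlt
  push Not at hlt
  have hGpos := wNorm_pos hf_c hf_pos hg_pos hG.1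
  obtain ⟨⟨m, hm, u, ε, hGs⟩, hGo⟩ := hG
  obtain ⟨⟨m', hm', u', ε', hHs⟩, hHo⟩ := hH
  obtain ⟨fin, fp, fb⟩ := spline_facts hr hg_c hg_pos hGs
  obtain ⟨fin', fp', fb'⟩ := spline_facts hr hg_c hg_pos hHs
  obtain ⟨hε, hu0, hum, hu, hGd, -⟩ := hGs
  obtain ⟨hε', hu0', hum', hu', hHd, -⟩ := hHs
  have cG := spline_chain ha hGd
  have cH := spline_chain ha hHd
  have bG := wNorm_bound hf_c hf_pos hGd.continuousOn
  obtain ⟨b, b1, b2, b3⟩ := osc_facts hGo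
  obtain ⟨c, c1, c2, c3⟩ := osc_facts hHo
  have hγ := gk1_mono hg_c hg_pos
  have E1 : ε = 1 := by
    refine orient (gk g 1) r n m hr a hm u ε hε hu0 hum fin _ _ cG (cG.smul 0) fp ?_ b b1 b2 ?_
    · intro s hs t ht hst
      simpa using hγ hs.1 ht.1 hst
    · intro i hi
      simp only [iteratedDerivWithin_zero, zero_mul, sub_zero]
      rw [b3 i hi, ← mul_assoc, neg_pow_sq, one_mul]
      exact mul_pos hGpos (hf_pos _ (b2 i hi).1)
  have E2 : -ε = 1 := by
    refine orient (gk g 1) r n m hr a hm u (-ε) ?_ hu0 hum fin _ _ (cG.smul (-1)) (cH.smul (-1))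
      ?_ ?_ c c1 c2 ?_
    · rcases hε with e | e <;> simp [e]
    · intro i hi s hs t ht
      have := fp i hi s hs t ht
      linarith
    · intro s hs t ht hst
      have := fb' s hs t ht hst
      rw [abs_sub_comm] at this
      convert this using 2
      ring
    · intro i hi
      simp only [iteratedDerivWithin_zero]
      have hb := abs_le.1 (bG (c i) (c2 i hi))
      have hfp := hf_pos _ (c2 i hi).1
      have := mul_lt_mul_of_pos_right hlt hfp
      have e := c3 i hi
      rcases neg_one_pow_eq_or ℝ (i + r) with h | h <;> rw [h] at e ⊢ <;> rw [e] <;>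
        linarith [hb.1, hb.2]
  linarith

lemma tail_alt {f g G : ℝ → ℝ} {r n m : ℕ} (hr : 1 ≤ r) {a N T : ℝ} (ha : 0 < a) {u : ℕ → ℝ}
    {ε : ℝ}
    (hg_c : ContinuousOn g (Ici 0)) (hg_pos : ∀ t ∈ Ici (0:ℝ), 0 < g t)
    (hG : PerfectSplineWith g r a m u ε G) (b : ℕ → ℝ)
    (hb : ∀ i, i + 1 < n + r + 1 → b i < b (i + 1)) 
    (hbm : ∀ i < n + r + 1, b i ∈ Icc 0 a)
    (hv : ∀ i < n + r + 1, G (b i) = (-1 : ℝ) ^ (i + r) * (N * f (b i)))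
    (hP : ∀ t, T ≤ t → |Pfun g r t| < N * f t) : b n < T := by
  by_contra hcon
  push Not at hcon
  obtain ⟨fin, fp, fb⟩ := spline_facts hr hg_c hg_pos hG
  have cG := spline_chain ha hG.2.2.2.2.1
  have cP : Chn (r - 1) (fun j t => (-1 : ℝ) ^ j * Pfun g (r - j) t) 0 a := by
    refine ⟨fun j _ => continuousOn_const.mul ((Pfun_cont hg_c _).mono Icc_subset_Ici_self), ?_⟩
    intro j hj t ht
    have := (Pfun_deriv hg_c (r - (j + 1)) ht.1).const_mul ((-1 : ℝ) ^ j)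
    rw [show r - (j + 1) + 1 = r - j by omega] at this
    refine this.congr_deriv ?_
    simp only [pow_succ]; ring
  have hbT : ∀ i < r + 1, T ≤ b (n + i) := by
    intro i
    induction i with
    | zero => intro _; exact hcon
    | succ i ih => intro hi; exact (ih (by omega)).trans (hb (n + i) (by omega)).le
  have hN2 : 2 + (r - 1) = r + 1 := by omega
  obtain ⟨c, c1, c2, c3⟩ := rolle_alt 0 a 2 (r - 1) (n + r) _ 
    (cG.sub (cP.smul ((-1 : ℝ) ^ (n + r)))) (fun i => b (n + i))
    (by rw [hN2]; exact fun i hi => hb (n + i) (by omega)) 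
    (by rw [hN2]; exact fun i hi => hbm (n + i) (by omega))
    (by
      rw [hN2]
      intro i hi
      have h1 := hv (n + i) (by omega)
      have h2 := abs_lt.1 (hP _ (hbT i hi))
      simp only [iteratedDerivWithin_zero, pow_zero, one_mul, Nat.sub_zero]
      rw [show n + i + r = i + (n + r) by ring] at h1
      rcases neg_one_pow_eq_or ℝ (i + (n + r)) with h | h <;> 
      rcases neg_one_pow_eq_or ℝ (n + r) with h' | h' <;> rw [h] at h1 ⊢ <;> rw [h', h1] <;> 
        linarith [h2.1, h2.2])
  have hc := c1 0 (by omega)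
  have m0 := c2 0 (by omega)
  have m1 := c2 1 (by omega)
  have s0 := c3 0 (by omega)
  have s1 := c3 1 (by omega)
  have hfb := abs_le.1 (fb _ m0 _ m1 hc.le)
  simp only [show r - (r - 1) = 1 by omega, zero_add] at s0 s1 hfb
  have hP1 : ∀ t, Pfun g 1 t = Acoef g 0 - gk g 1 t := by
    intro t; simp [Pfun]; ring
  rw [hP1] at s0 s1
  set A := Acoef g 0
  obtain ⟨q, rfl⟩ : ∃ q, r = q + 1 := ⟨r - 1, by omega⟩
  simp only [Nat.add_sub_cancel] at s0 s1 hfb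
  have e0 : (-1 : ℝ) ^ (n + (q + 1) + q) = - (-1 : ℝ) ^ n := by
    rw [show n + (q + 1) + q = n + (q + q) + 1 by ring, pow_succ, pow_add, pow_add, neg_pow_sq]; ring
  have e1 : (-1 : ℝ) ^ (1 + (n + (q + 1)) + q) = (-1 : ℝ) ^ n := by
    rw [show 1 + (n + (q + 1)) + q = n + (q + 1) + q + 1 by ring, pow_succ, e0]; ring
  have e2 : ∀ x : ℝ, (-1 : ℝ) ^ (n + (q + 1)) * ((-1 : ℝ) ^ q * x) = - (-1 : ℝ) ^ n * x := by
    intro x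
    rw [← mul_assoc, ← pow_add, e0]
  rw [e0, e2] at s0
  rw [e1, e2] at s1
  rcases neg_one_pow_eq_or ℝ n with h | h <;> rw [h] at s0 s1 <;> linarith [hfb.1, hfb.2]

/-- Lemma 6: if φ_{r,0,f}(∞) < ∞ and f(t)/|P_r(t)| → ∞, then any locally uniform
limit P of the splines G_{r,n,f,M_k} (M_k → ∞) has at least n-1 oscillation points,
i.e. points t ≥ 0 with |P(t)| = φ_{r,n,f}(∞)·f(t). -/
theorem statement16
    (f g : ℝ → ℝ)
    (hf_c : ContinuousOn f (Ici 0)) (hf_pos : ∀ t ∈ Ici (0:ℝ), 0 < f t)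
    (hf_anti : AntitoneOn f (Ici 0))
    (hg_c : ContinuousOn g (Ici 0)) (hg_pos : ∀ t ∈ Ici (0:ℝ), 0 < g t)
    (hg_anti : AntitoneOn g (Ici 0))
    (r : ℕ) (hr : 1 ≤ r)
    (φ0 : ℝ → ℝ)
    (hφ0 : ∀ a, 0 < a → ∃ G : ℝ → ℝ,
      IsExtremalSpline f g r 0 a G ∧ φ0 a = wNorm G f (Icc 0 a))
    (hfin : ∃ C, ∀ a, 0 < a → φ0 a ≤ C)
    (hratio : Tendsto (fun t => f t / |Pfun g r t|) atTop atTop)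
    (n : ℕ) (hn : 1 ≤ n)
    (M : ℕ → ℝ) (hMpos : ∀ k, 0 < M k) (hMtop : Tendsto M atTop atTop)
    (GM : ℕ → ℝ → ℝ) (hGM : ∀ k, IsExtremalSpline f g r n (M k) (GM k))
    (P : ℝ → ℝ)
    (hconv : ∀ c, 0 < c → TendstoUniformlyOn (fun k => GM k) P atTop (Icc 0 c))
    (φn : ℝ → ℝ)
    (hφn : ∀ a, 0 < a → ∃ G : ℝ → ℝ,
      IsExtremalSpline f g r n a G ∧ φn a = wNorm G f (Icc 0 a))
    (L : ℝ) (hL : Tendsto φn atTop (nhds L)) :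
    ∃ T : Finset ℝ, n - 1 ≤ T.card ∧ ∀ t ∈ T, t ∈ Ici (0:ℝ) ∧ |P t| = L * f t := by
  have hNeq : ∀ k, wNorm (GM k) f (Icc 0 (M k)) = φn (M k) := by
    intro k
    obtain ⟨G, hG, e⟩ := hφn (M k) (hMpos k)
    rw [e]
    exact le_antisymm (wNorm_unique_aux hr (hMpos k) hf_c hf_pos hg_c hg_pos hG (hGM k))
      (wNorm_unique_aux hr (hMpos k) hf_c hf_pos hg_c hg_pos (hGM k) hG)
  have hNL : Tendsto (fun k => wNorm (GM k) f (Icc 0 (M k))) atTop (𝓝 L) := by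
    simp only [hNeq]
    exact hL.comp hMtop
  have hNpos : ∀ k, 0 < wNorm (GM k) f (Icc 0 (M k)) := fun k =>
    wNorm_pos hf_c hf_pos hg_pos (hGM k).1
  have hcont : ∀ k, ContinuousOn (GM k) (Icc 0 (M k)) := by
    intro k
    obtain ⟨⟨m, hm, u, ε, hs⟩, -⟩ := hGM k
    exact hs.2.2.2.2.1.continuousOn
  have hL0 : 0 ≤ L := ge_of_tendsto' hNL fun k => (hNpos k).le
  rcases hL0.eq_or_lt with hL0 | hL0
  · subst hL0
    refine ⟨(Finset.range n).image (fun i : ℕ => (i : ℝ)), ?_, ?_⟩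
    · rw [Finset.card_image_of_injective _ Nat.cast_injective, Finset.card_range]; omega
    · intro t ht
      obtain ⟨i, -, rfl⟩ := Finset.mem_image.1 ht
      have h0 : (0 : ℝ) ≤ i := Nat.cast_nonneg i
      refine ⟨h0, ?_⟩
      have h1 : Tendsto (fun k => GM k (i : ℝ)) atTop (𝓝 (P i)) :=
        (hconv (i + 1) (by linarith)).tendsto_at ⟨h0, by linarith⟩
      have h2 : Tendsto (fun k => wNorm (GM k) f (Icc 0 (M k)) * f i) atTop (𝓝 (0 * f i)) :=
        hNL.mul_const _
      have h3 := le_of_tendsto_of_tendsto h1.abs h2 (by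
        filter_upwards [hMtop.eventually_ge_atTop (i : ℝ)] with k hk
        exact wNorm_bound hf_c hf_pos (hcont k) _ ⟨h0, hk⟩)
      rw [zero_mul] at h3 ⊢
      exact le_antisymm h3 (abs_nonneg _)
  obtain ⟨T0, hT0⟩ := eventually_atTop.1 (hratio.eventually_gt_atTop (2 / L))
  set T := max T0 1 with hTdef
  have hT1 : 1 ≤ T := le_max_right _ _
  have hPT : ∀ t, T ≤ t → |Pfun g r t| < L / 2 * f t := by
    intro t ht
    have h1 := hT0 t ((le_max_left _ _).trans ht)
    have hfp := hf_pos t (by rw [mem_Ici]; linarith)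
    rcases (abs_nonneg (Pfun g r t)).eq_or_lt with h | h
    · rw [← h]; positivity
    · rw [div_lt_div_iff₀ hL0 h] at h1
      linarith
  obtain ⟨K, hK⟩ := eventually_atTop.1 ((hNL.eventually (lt_mem_nhds (half_lt_self hL0))).and
    (hMtop.eventually_ge_atTop T))
  have hosc : ∀ k, ∃ b : ℕ → ℝ, (∀ i, i + 1 < n + r + 1 → b i < b (i + 1)) ∧ 
      (∀ i < n + r + 1, b i ∈ Icc 0 (M k)) ∧
      (∀ i < n + r + 1, GM k (b i) =
        (-1 : ℝ) ^ (i + r) * (wNorm (GM k) f (Icc 0 (M k)) * f (b i))) ∧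
      (K ≤ k → b n < T) := by
    intro k
    obtain ⟨b, b1, b2, b3⟩ := osc_facts (hGM k).2
    refine ⟨b, b1, b2, b3, fun hk => ?_⟩
    obtain ⟨⟨m, hm, u, ε, hs⟩, -⟩ := hGM k
    refine tail_alt hr (hMpos k) hg_c hg_pos hs b b1 b2 b3 ?_
    intro t ht
    refine (hPT t ht).trans ?_
    exact mul_lt_mul_of_pos_right (hK k hk).1 (hf_pos t (by rw [mem_Ici]; linarith))
  choose b b1 b2 b3 b4 using hosc
  have bT : ∀ k, K ≤ k → ∀ i ≤ n, b k i ∈ Icc 0 T := by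
    intro k hk i hi
    refine ⟨(b2 k i (by omega)).1, ?_⟩
    refine le_trans ?_ (b4 k hk).le
    clear b3 b4
    induction hi using Nat.decreasingInduction with
    | self => exact le_rfl
    | of_succ j hj ih => exact (b1 k j (by omega)).le.trans ih
  have hcomp : IsCompact (Set.pi univ (fun _ : Fin (n + 1) => Icc (0:ℝ) T)) :=
    isCompact_univ_pi fun _ => isCompact_Icc
  obtain ⟨t, htm, ψ, hψ, htend⟩ := hcomp.tendsto_subseq
    (x := fun k (i : Fin (n + 1)) => b (k + K) i)
    (fun k i _ => bT (k + K) (by omega) i (by have := i.2; omega))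
  have htm' : ∀ i, t i ∈ Icc 0 T := fun i => htm i (mem_univ i)
  have hti : ∀ i : Fin (n + 1), Tendsto (fun k => b (ψ k + K) i) atTop (𝓝 (t i)) := fun i =>
    (tendsto_pi_nhds.1 htend) i
  have hidx : Tendsto (fun k => ψ k + K) atTop atTop :=
    tendsto_atTop_mono (fun k => Nat.le_add_right _ _) hψ.tendsto_atTop
  have hPc : ContinuousOn P (Icc 0 T) := by
    refine (hconv T (by linarith)).continuousOn ?_
    refine Eventually.frequently ?_
    filter_upwards [eventually_ge_atTop K] with k hk
    exact (hcont k).mono (Icc_subset_Icc_right (hK k hk).2)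
  have hval : ∀ i : Fin (n + 1), P (t i) = (-1 : ℝ) ^ ((i : ℕ) + r) * (L * f (t i)) := by
    intro i
    have hw : Tendsto (fun k => b (ψ k + K) i) atTop (𝓝[Icc 0 T] (t i)) := by
      refine tendsto_nhdsWithin_iff.2 ⟨hti i, Eventually.of_forall fun k => ?_⟩
      exact bT _ (by omega) i (by have := i.2; omega)
    have hu := (hconv T (by linarith))
    have l1 : Tendsto (fun k => P (b (ψ k + K) i)) atTop (𝓝 (P (t i))) :=
      (hPc (t i) (htm' i)).tendsto.comp hw
    have l2 : Tendsto (fun k => P (b (ψ k + K) i) - GM (ψ k + K) (b (ψ k + K) i))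
        atTop (𝓝 0) := by
      rw [Metric.tendsto_nhds]
      intro e he
      filter_upwards [hidx.eventually (Metric.tendstoUniformlyOn_iff.1 hu e he)] with k hk
      have := hk _ (bT (ψ k + K) (by omega) i (by have := i.2; omega))
      rwa [Real.dist_eq, sub_zero, ← Real.dist_eq]
    have l3 := l1.sub l2
    simp only [sub_sub_cancel, sub_zero] at l3
    have l4 : Tendsto (fun k => f (b (ψ k + K) i)) atTop (𝓝 (f (t i))) :=
      ((hf_c.mono Icc_subset_Ici_self) (t i) (htm' i)).tendsto.comp hw
    have l5 := ((hNL.comp hidx).mul l4).const_mul ((-1 : ℝ) ^ ((i : ℕ) + r))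
    refine tendsto_nhds_unique l3 (l5.congr fun k => ?_)
    rw [b3 _ i (by have := i.2; omega)]
    rfl
  have hmono : StrictMono t := by
    refine Fin.strictMono_iff_lt_succ.2 fun i => ?_
    have hle : t i.castSucc ≤ t i.succ := by
      refine le_of_tendsto_of_tendsto' (hti _) (hti _) fun k => ?_
      have := i.2
      simpa using (b1 (ψ k + K) i (by omega)).le
    refine lt_of_le_of_ne hle fun he => ?_
    have v1 := hval i.castSucc
    have v2 := hval i.succ
    rw [he] at v1
    rw [v1] at v2
    simp only [Fin.val_castSucc, Fin.val_succ] at v2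
    rw [show (i : ℕ) + 1 + r = i + r + 1 by ring, pow_succ] at v2
    have hp : 0 < L * f (t i.succ) := mul_pos hL0 (hf_pos _ (htm' _).1)
    rcases neg_one_pow_eq_or ℝ ((i : ℕ) + r) with h | h <;> rw [h] at v2 <;> linarith
  refine ⟨Finset.univ.image t, ?_, ?_⟩
  · rw [Finset.card_image_of_injective _ hmono.injective, Finset.card_univ, Fintype.card_fin]
    omega
  · intro s hs
    obtain ⟨i, -, rfl⟩ := Finset.mem_image.1 hs
    refine ⟨(htm' i).1, ?_⟩
    rw [hval, abs_mul, abs_pow, abs_neg, abs_one, one_pow, one_mul, abs_of_pos]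
    exact mul_pos hL0 (hf_pos _ (htm' i).1)
end
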